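/- (Lemma 6, RIP for the perturbed matrix.) Let A, Φ ∈ ℂ^{m×d}, let s ≥ 1, and suppose A satisfies the restricted isometry property with parameters (s, δ) for some 0 ≤ δ < 1 and A ≠ 0. Let ε = ‖A − Φ‖^{(s)}/‖A‖^{(s)}. Then Φ satisfies the restricted isometry property with parameters (s, δ̂) where δ̂ = (1 + δ)(1 + ε)² − 1; that is, for every x ∈ ℂ^d with at most s nonzero entries, (2 − (1 + δ)(1 + ε)²) ‖x‖₂² ≤ ‖Φx‖₂² ≤ (1 + δ)(1 + ε)² ‖x‖₂². -/

import Mathlib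

open scoped BigOperators

/-- The Euclidean (ℓ²) norm of a vector. -/
noncomputable def l2 {n : ℕ} (x : Fin n → ℂ) : ℝ := Real.sqrt (∑ i, ‖x i‖ ^ 2)

/-- The ℓ¹ norm of a vector. -/
noncomputable def l1 {n : ℕ} (x : Fin n → ℂ) : ℝ := ∑ i, ‖x i‖

/-- `x` has at most `s` nonzero entries. -/
def Sparse {n : ℕ} (s : ℕ) (x : Fin n → ℂ) : Prop :=
  ∃ T : Finset (Fin n), T.card ≤ s ∧ ∀ i ∉ T, x i = 0

/-- `A` satisfies the restricted isometry property with parameters `(s, δ)`. -/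
def RIP {m d : ℕ} (A : Matrix (Fin m) (Fin d) ℂ) (s : ℕ) (δ : ℝ) : Prop :=
  ∀ x : Fin d → ℂ, Sparse s x →
    (1 - δ) * (l2 x) ^ 2 ≤ (l2 (A.mulVec x)) ^ 2 ∧
      (l2 (A.mulVec x)) ^ 2 ≤ (1 + δ) * (l2 x) ^ 2

/-- The spectral norm `‖M‖₂` of a matrix. -/
noncomputable def specNorm {m d : ℕ} (M : Matrix (Fin m) (Fin d) ℂ) : ℝ :=
  sSup {r | ∃ x : Fin d → ℂ, l2 x ≤ 1 ∧ r = l2 (M.mulVec x)}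

/-- `‖M‖^{(s)}`: the largest spectral norm over all `s`-column submatrices of `M`,
equivalently the sup of `‖Mx‖₂` over `s`-sparse `x` with `‖x‖₂ ≤ 1`. -/
noncomputable def specNormS {m d : ℕ} (s : ℕ) (M : Matrix (Fin m) (Fin d) ℂ) : ℝ :=
  sSup {r | ∃ x : Fin d → ℂ, Sparse s x ∧ l2 x ≤ 1 ∧ r = l2 (M.mulVec x)}

/-- `xs` is a best `s`-sparse approximation of `x`: it keeps `s` entries of `x` of
largest magnitude (all entries if `x` has fewer than `s` coordinates) and sets the
others to zero. -/
def IsSparseApprox {n : ℕ} (s : ℕ) (x xs : Fin n → ℂ) : Prop :=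
  ∃ T : Finset (Fin n), T.card = min s n ∧
    (∀ i, xs i = if i ∈ T then x i else 0) ∧
    ∀ i ∈ T, ∀ j ∉ T, ‖x j‖ ≤ ‖x i‖

theorem l2_eq_norm_toLp {n : ℕ} (x : Fin n → ℂ) : l2 x = ‖WithLp.toLp 2 x‖ := by
  simp [l2, EuclideanSpace.norm_eq]

theorem l2_nonneg {n : ℕ} (x : Fin n → ℂ) : 0 ≤ l2 x := Real.sqrt_nonneg _

theorem l2_zero {n : ℕ} : l2 (0 : Fin n → ℂ) = 0 := by
  simp [l2]

theorem l2_eq_zero {n : ℕ} {x : Fin n → ℂ} : l2 x = 0 ↔ x = 0 := by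
  simp [l2_eq_norm_toLp]

theorem l2_smul {n : ℕ} (c : ℂ) (x : Fin n → ℂ) : l2 (c • x) = ‖c‖ * l2 x := by
  simp only [l2_eq_norm_toLp, WithLp.toLp_smul, norm_smul]

theorem l2_sub_le {n : ℕ} (x y : Fin n → ℂ) : l2 (x - y) ≤ l2 x + l2 y := by
  simp only [l2_eq_norm_toLp, WithLp.toLp_sub]
  exact norm_sub_le _ _

theorem l2_le_add_l2_sub {n : ℕ} (x y : Fin n → ℂ) : l2 x ≤ l2 y + l2 (x - y) := by
  simp only [l2_eq_norm_toLp, WithLp.toLp_sub]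
  exact norm_le_norm_add_norm_sub' _ _

theorem Sparse.smul {n s : ℕ} {x : Fin n → ℂ} (hx : Sparse s x) (c : ℂ) : Sparse s (c • x) := by
  obtain ⟨T, hT, h⟩ := hx
  exact ⟨T, hT, fun i hi => by simp [h i hi]⟩

theorem sparse_zero {n s : ℕ} : Sparse s (0 : Fin n → ℂ) :=
  ⟨∅, by simp, fun _ _ => rfl⟩

theorem sparse_single {n s : ℕ} (hs : 1 ≤ s) (j : Fin n) (c : ℂ) : Sparse s (Pi.single j c) :=
  ⟨{j}, by simpa using hs, fun i hi => by simp [Finset.notMem_singleton.mp hi]⟩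

open scoped Matrix.Norms.L2Operator in
theorem bddAbove_specNormS {m d : ℕ} (s : ℕ) (M : Matrix (Fin m) (Fin d) ℂ) :
    BddAbove {r | ∃ x : Fin d → ℂ, Sparse s x ∧ l2 x ≤ 1 ∧ r = l2 (M.mulVec x)} := by
  refine ⟨‖M‖, ?_⟩
  rintro r ⟨x, -, hx, rfl⟩
  have h := Matrix.l2_opNorm_mulVec M (WithLp.toLp 2 x)
  rw [l2_eq_norm_toLp] at hx ⊢
  exact h.trans (mul_le_of_le_one_right (norm_nonneg _) hx)

theorem specNormS_nonneg {m d : ℕ} (s : ℕ) (M : Matrix (Fin m) (Fin d) ℂ) :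
    0 ≤ specNormS s M :=
  Real.sSup_nonneg (by rintro r ⟨x, -, -, rfl⟩; exact l2_nonneg _)

theorem l2_mulVec_le_specNormS_mul {m d s : ℕ} (M : Matrix (Fin m) (Fin d) ℂ) {x : Fin d → ℂ}
    (hx : Sparse s x) : l2 (M.mulVec x) ≤ specNormS s M * l2 x := by
  rcases eq_or_ne x 0 with rfl | hx0
  · simp [l2_zero]
  have hpos : 0 < l2 x := (l2_nonneg x).lt_of_ne' (l2_eq_zero.not.mpr hx0)
  have hnorm : ‖((l2 x)⁻¹ : ℂ)‖ = (l2 x)⁻¹ := by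
    rw [norm_inv, Complex.norm_of_nonneg hpos.le]
  have h : l2 (M.mulVec (((l2 x)⁻¹ : ℂ) • x)) ≤ specNormS s M :=
    le_csSup (bddAbove_specNormS s M)
      ⟨_, hx.smul _, by rw [l2_smul, hnorm, inv_mul_cancel₀ hpos.ne'], rfl⟩
  rwa [Matrix.mulVec_smul, l2_smul, hnorm, inv_mul_le_iff₀ hpos, mul_comm] at h

theorem specNormS_pos {m d s : ℕ} (hs : 1 ≤ s) {M : Matrix (Fin m) (Fin d) ℂ} (hM : M ≠ 0) :
    0 < specNormS s M := by
  refine (specNormS_nonneg s M).lt_of_ne' fun h0 => hM ?_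
  ext i j
  have h := l2_mulVec_le_specNormS_mul M (sparse_single hs j 1)
  rw [h0, zero_mul] at h
  have hz := congrFun (l2_eq_zero.mp (h.antisymm (l2_nonneg _))) i
  simpa using hz

theorem RIP.specNormS_le_sqrt {m d s : ℕ} {A : Matrix (Fin m) (Fin d) ℂ} {δ : ℝ} (hδ : 0 ≤ 1 + δ)
    (hA : RIP A s δ) : specNormS s A ≤ √(1 + δ) := by
  refine csSup_le ⟨_, 0, sparse_zero, by simp [l2_zero], rfl⟩ ?_
  rintro r ⟨x, hx, hx1, rfl⟩
  refine Real.le_sqrt_of_sq_le ((hA x hx).2.trans (mul_le_of_le_one_right hδ ?_))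
  exact pow_le_one₀ (l2_nonneg x) hx1

/-- Lemma 6 (Herman–Strohmer): RIP for the perturbed matrix `Φ`. -/
theorem rip_perturbed (m d s : ℕ) (hs : 1 ≤ s)
    (A Φ : Matrix (Fin m) (Fin d) ℂ) (hA : A ≠ 0)
    (δ : ℝ) (hδ0 : 0 ≤ δ) (hδ1 : δ < 1) (hRIP : RIP A s δ) :
    RIP Φ s ((1 + δ) * (1 + specNormS s (A - Φ) / specNormS s A) ^ 2 - 1) := by
  intro x hx
  obtain ⟨hlow, hupp⟩ := hRIP x hx
  have hApos := specNormS_pos hs hA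
  set ε := specNormS s (A - Φ) / specNormS s A with hε
  have hε0 : 0 ≤ ε := div_nonneg (specNormS_nonneg _ _) hApos.le
  set a := √(1 - δ) with ha
  set b := √(1 + δ) with hb
  have ha0 : 0 ≤ a := Real.sqrt_nonneg _
  have hb0 : 0 ≤ b := Real.sqrt_nonneg _
  have ha2 : a ^ 2 = 1 - δ := Real.sq_sqrt (by linarith)
  have hb2 : b ^ 2 = 1 + δ := Real.sq_sqrt (by linarith)
  have hab : a ≤ b := Real.sqrt_le_sqrt (by linarith)
  have hx0 := l2_nonneg x
  have hΦ0 := l2_nonneg (Φ.mulVec x)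
  have hE : l2 (A.mulVec x - Φ.mulVec x) ≤ ε * b * l2 x := by
    rw [← Matrix.sub_mulVec]
    refine (l2_mulVec_le_specNormS_mul _ hx).trans (mul_le_mul_of_nonneg_right ?_ hx0)
    calc specNormS s (A - Φ) = ε * specNormS s A := (div_mul_cancel₀ _ hApos.ne').symm
      _ ≤ ε * b := mul_le_mul_of_nonneg_left (hRIP.specNormS_le_sqrt (by linarith)) hε0
  have hAupp : l2 (A.mulVec x) ≤ b * l2 x :=
    le_of_pow_le_pow_left₀ two_ne_zero (by positivity) (by rw [mul_pow, hb2]; exact hupp)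
  have hAlow : a * l2 x ≤ l2 (A.mulVec x) :=
    le_of_pow_le_pow_left₀ two_ne_zero (l2_nonneg _) (by rw [mul_pow, ha2]; exact hlow)
  constructor
  · have hΦ : (a - ε * b) * l2 x ≤ l2 (Φ.mulVec x) := by
      linarith [l2_le_add_l2_sub (A.mulVec x) (Φ.mulVec x)]
    have hεb : 0 ≤ ε * b := mul_nonneg hε0 hb0
    rcases le_total (ε * b) a with h | h
    · have hsq := pow_le_pow_left₀ (mul_nonneg (sub_nonneg.mpr h) hx0) hΦ 2
      refine le_trans ?_ hsq
      rw [mul_pow, ← hb2]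
      refine mul_le_mul_of_nonneg_right ?_ (sq_nonneg _)
      nlinarith [mul_nonneg hεb (sub_nonneg.mpr hab), sq_nonneg (ε * b)]
    · refine le_trans (mul_nonpos_of_nonpos_of_nonneg ?_ (sq_nonneg _)) (sq_nonneg _)
      rw [← hb2]
      nlinarith [pow_le_pow_left₀ ha0 h 2, mul_nonneg hεb hb0]
  · have hΦ : l2 (Φ.mulVec x) ≤ b * (1 + ε) * l2 x := by
      have h := l2_sub_le (A.mulVec x) (A.mulVec x - Φ.mulVec x)
      rw [sub_sub_cancel] at h
      linarith
    calc l2 (Φ.mulVec x) ^ 2 ≤ (b * (1 + ε) * l2 x) ^ 2 := pow_le_pow_left₀ hΦ0 hΦ 2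
      _ = (1 + ((1 + δ) * (1 + ε) ^ 2 - 1)) * l2 x ^ 2 := by rw [← hb2]; ring
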